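/- Let 0 < θ < 1/110 and c > 0 and α > 0 be fixed. For each prime N, let W be a random subset of Z_N in which the events x ∈ W (x ranging over Z_N) are independent, each with probability p = p(N) ∈ (cN^{-θ}, 1]. Then for every ε > 0 there is N₀ such that for all primes N ≥ N₀, the probability that the following holds is at least 1 − ε: every set A ⊆ W with |A| ≥ α|W| contains two elements x, y with x − y equal to a nonzero perfect square (of an integer). -/

import Mathlib

open scoped Classical BigOperators

/-- The probability, under the product Bernoulli(p) measure on subsets of `ZMod N`,
of the event `E` of subsets of `ZMod N`. -/
noncomputable def randomSetProb (N : ℕ) [NeZero N] (p : ℝ)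
    (E : Finset (ZMod N) → Prop) : ℝ :=
  ∑ W ∈ (Finset.univ : Finset (ZMod N)).powerset,
    if E W then p ^ W.card * (1 - p) ^ (N - W.card) else 0

/-- No two elements of `A` differ by a nonzero perfect square. -/
def SquareDiffFree (A : Finset ℤ) : Prop :=
  ∀ x ∈ A, ∀ y ∈ A, ∀ n : ℕ, 0 < n → x - y ≠ (n : ℤ) ^ 2

/-- The largest size of a subset of `{0, …, L - 1}` without nonzero square differences. -/
noncomputable def maxSquareDiffFree (L : ℕ) : ℕ :=
  ((Finset.Ico (0 : ℤ) L).powerset.filter SquareDiffFree).sup Finset.card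

theorem card_le_maxSquareDiffFree {A : Finset ℤ} {L : ℕ} (hA : A ⊆ Finset.Ico (0 : ℤ) L)
    (hfree : SquareDiffFree A) : A.card ≤ maxSquareDiffFree L :=
  Finset.le_sup (f := Finset.card)
    (Finset.mem_filter.2 ⟨Finset.mem_powerset.2 hA, hfree⟩)

theorem exists_card_eq_maxSquareDiffFree (L : ℕ) :
    ∃ A ⊆ Finset.Ico (0 : ℤ) L, SquareDiffFree A ∧ A.card = maxSquareDiffFree L := by
  have hne : ((Finset.Ico (0 : ℤ) L).powerset.filter SquareDiffFree).Nonempty :=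
    ⟨∅, by simp [SquareDiffFree]⟩
  obtain ⟨A, hA, h⟩ := Finset.exists_mem_eq_sup _ hne Finset.card
  rw [Finset.mem_filter, Finset.mem_powerset] at hA
  exact ⟨A, hA.1, hA.2, h.symm⟩

/-- If a progression with square step meets `A` in more points than `maxSquareDiffFree` allows,
then two of these points have indices differing by a nonzero square. -/
theorem exists_sq_of_maxSquareDiffFree_lt {A : Finset ℤ} {a : ℤ} {q L : ℕ}
    (h : maxSquareDiffFree L < ((Finset.range L).filter fun i : ℕ => a + q ^ 2 * i ∈ A).card) :
    ∃ i < L, ∃ j < L, ∃ n : ℕ, 0 < n ∧ (i : ℤ) - j = (n : ℤ) ^ 2 ∧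
      a + q ^ 2 * i ∈ A ∧ a + q ^ 2 * j ∈ A := by
  by_contra! hno
  refine h.not_ge ?_
  rw [← Finset.card_image_of_injective _ (Nat.cast_injective (R := ℤ))]
  refine card_le_maxSquareDiffFree ?_ ?_
  · intro x hx
    simp only [Finset.mem_image, Finset.mem_filter, Finset.mem_range] at hx
    obtain ⟨i, hi, rfl⟩ := hx
    simp [hi.1]
  · intro x hx y hy n hn hxy
    simp only [Finset.mem_image, Finset.mem_filter, Finset.mem_range] at hx hy
    obtain ⟨i, hi, rfl⟩ := hx
    obtain ⟨j, hj, rfl⟩ := hy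
    exact hno i hi.1 j hj.1 n hn hxy hi.2 hj.2

theorem SquareDiffFree.card_sq_step_le {A : Finset ℤ} (hA : SquareDiffFree A) (a : ℤ) {q : ℕ}
    (hq : 0 < q) (L : ℕ) :
    ((Finset.range L).filter fun i : ℕ => a + q ^ 2 * i ∈ A).card ≤ maxSquareDiffFree L := by
  by_contra! h
  obtain ⟨i, -, j, -, n, hn, hij, hi, hj⟩ := exists_sq_of_maxSquareDiffFree_lt h
  refine hA _ hi _ hj (q * n) (by positivity) ?_
  push_cast
  linear_combination (q : ℤ) ^ 2 * hij

theorem SquareDiffFree.card_step_le {A : Finset ℤ} (hA : SquareDiffFree A) (a : ℤ) {q : ℕ}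
    (hq : 0 < q) (L : ℕ) :
    ((Finset.range (q * L)).filter fun i : ℕ => a + q * i ∈ A).card
      ≤ q * maxSquareDiffFree L := by
  have hmaps : ∀ i ∈ (Finset.range (q * L)).filter (fun i : ℕ => a + q * i ∈ A),
      i % q ∈ Finset.range q := fun i _ => Finset.mem_range.2 (Nat.mod_lt _ hq)
  have key := Finset.card_le_mul_card_image_of_maps_to hmaps (maxSquareDiffFree L) ?_
  · simpa [mul_comm] using key
  · intro l _
    refine le_trans ?_ (hA.card_sq_step_le (a + q * l) hq L)
    refine Finset.card_le_card_of_injOn (fun i => i / q) ?_ ?_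
    · intro i hi
      simp only [Finset.coe_filter, Finset.mem_filter, Finset.mem_range, Set.mem_ofPred_eq] at hi ⊢
      obtain ⟨⟨h1, h2⟩, h3⟩ := hi
      refine ⟨Nat.div_lt_of_lt_mul h1, ?_⟩
      have h4 : ((q * (i / q) + i % q : ℕ) : ℤ) = i := by rw [Nat.div_add_mod]
      rw [h3] at h4
      push_cast at h4 ⊢
      have : a + q * l + (q : ℤ) ^ 2 * ((i : ℤ) / q) = a + q * i := by
        linear_combination (q : ℤ) * h4
      rwa [this]
    · intro i hi j hj hij
      simp only [Finset.coe_filter, Finset.mem_filter, Finset.mem_range, Set.mem_ofPred_eq] at hi hj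
      rw [← Nat.div_add_mod i q, ← Nat.div_add_mod j q, hi.2, hj.2]
      simp only at hij
      rw [hij]

theorem subadditive_maxSquareDiffFree :
    Subadditive fun L => (maxSquareDiffFree L : ℝ) := by
  intro m n
  obtain ⟨A, hA, hfree, hcard⟩ := exists_card_eq_maxSquareDiffFree (m + n)
  have hsub : ∀ (k : ℕ) (a : ℤ),
      (A.filter fun x => a ≤ x ∧ x < a + k).card ≤ maxSquareDiffFree k := by
    intro k a
    refine le_trans ?_ (hfree.card_sq_step_le a one_pos k)
    refine Finset.card_le_card_of_injOn (fun x => (x - a).toNat) ?_ ?_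
    · intro x hx
      simp only [Finset.coe_filter, Finset.mem_range, Set.mem_ofPred_eq] at hx ⊢
      refine ⟨by omega, ?_⟩
      have : a + ((1 : ℕ) : ℤ) ^ 2 * ((x - a).toNat : ℤ) = x := by
        rw [Int.toNat_of_nonneg (by omega)]; simp
      rw [this]; exact hx.1
    · intro x hx y hy hxy
      simp only [Finset.coe_filter, Set.mem_ofPred_eq] at hx hy hxy
      omega
  have hunion : A ⊆ (A.filter fun x => (0 : ℤ) ≤ x ∧ x < 0 + m) ∪
      (A.filter fun x => (m : ℤ) ≤ x ∧ x < m + n) := by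
    intro x hx
    have := Finset.mem_Ico.1 (hA hx)
    simp only [Finset.mem_union, Finset.mem_filter, hx, true_and]
    push_cast at this
    omega
  have := (Finset.card_le_card hunion).trans (Finset.card_union_le _ _)
  show (maxSquareDiffFree (m + n) : ℝ) ≤ maxSquareDiffFree m + maxSquareDiffFree n
  rw [← hcard]
  exact_mod_cast this.trans (add_le_add (hsub m 0) (hsub n m))

/-- Second moment of the number of points of `A` among `n + (r + 1)², …, n + (r + H)²`. -/
theorem SquareDiffFree.second_moment_le {A : Finset ℤ} (hA : SquareDiffFree A) {N H L : ℕ}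
    {δ ε : ℝ} (hδ : 0 < δ) (hAN : A ⊆ Finset.Ico (0 : ℤ) N) (hcard : δ * N ≤ A.card)
    (hH : 0 < H) (hL : 0 < L)
    (hmax : ∀ k, L ≤ k → (maxSquareDiffFree k : ℝ) ≤ (δ + ε) * k) :
    (A.card : ℝ) * δ ^ 2 ≤
      A.card * (1 / H + ε) + ((2 * H.factorial * L + H : ℕ) : ℝ) ^ 2 * δ ^ 2 := by
  set R := 2 * H.factorial * L with hR
  set T : ℕ := (R + H) ^ 2 with hT
  set I := Finset.Ico (-(T : ℤ)) N with hI
  set f : ℤ → ℝ := fun x => if x ∈ A then 1 else 0 with hf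
  set g : ℕ → ℤ → ℝ := fun r n => ∑ h ∈ Finset.range H, f (n + ((r + h + 1 : ℕ) : ℤ) ^ 2) with hg
  have hRpos : 0 < R := by positivity
  have hIcard : (I.card : ℝ) = N + T := by
    have : ((I.card : ℕ) : ℤ) = N + T := by
      rw [hI, Int.card_Ico]; omega
    exact_mod_cast this
  have hAI : A ⊆ I := hAN.trans (Finset.Ico_subset_Ico (by omega) le_rfl)
  have hsq : ∀ r < R, ∀ h < H, ((r + h + 1 : ℕ) : ℤ) ^ 2 ≤ T := by
    intro r hr h hh
    rw [hT]; push_cast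
    have : (r : ℤ) + h + 1 ≤ R + H := by omega
    gcongr
  have hshift : ∀ (F : ℤ → ℝ), (∀ x, x ∉ A → F x = 0) → ∀ c : ℤ, 0 ≤ c → c ≤ T →
      ∑ n ∈ I, F (n + c) = ∑ x ∈ A, F x := by
    intro F hF c hc0 hcT
    have h1 : ∑ n ∈ I, F (n + c) = ∑ x ∈ I.map (addRightEmbedding c), F x := by
      rw [Finset.sum_map]; rfl
    rw [h1]
    symm
    apply Finset.sum_subset
    · intro x hx
      have := Finset.mem_Ico.1 (hAN hx)
      simp only [Finset.mem_map, addRightEmbedding_apply, hI, Finset.mem_Ico]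
      exact ⟨x - c, by omega, by omega⟩
    · intro x _ hx
      exact hF x hx
  have hfA : ∀ x, x ∉ A → f x = 0 := fun x hx => by simp [hf, hx]
  have hsumf : ∑ x ∈ A, f x = A.card := by
    rw [Finset.sum_congr rfl (fun x hx => by simp [hf, hx] : ∀ x ∈ A, f x = 1)]; simp
  have hfirst : ∀ r < R, ∑ n ∈ I, g r n = H * A.card := by
    intro r hr
    simp only [hg]
    rw [Finset.sum_comm]
    rw [Finset.sum_congr rfl (fun h hh => by
      rw [hshift f hfA _ (by positivity) (hsq r hr h (Finset.mem_range.1 hh)), hsumf])]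
    simp
  have hlower : ∀ r < R, (A.card : ℝ) * (δ * H) ^ 2 ≤ ∑ n ∈ I, (g r n - δ * H) ^ 2 := by
    intro r hr
    have h0 : ∀ n ∈ A, g r n = 0 := by
      intro n hn
      refine Finset.sum_eq_zero fun h _ => hfA _ fun hmem => ?_
      exact hA _ hmem _ hn (r + h + 1) (by omega) (by ring)
    calc (A.card : ℝ) * (δ * H) ^ 2 = ∑ n ∈ A, (g r n - δ * H) ^ 2 := by
          rw [Finset.sum_congr rfl (fun n hn => by rw [h0 n hn])]; simp
      _ ≤ _ := Finset.sum_le_sum_of_subset_of_nonneg hAI fun _ _ _ => sq_nonneg _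
  have hstep : ∀ k, 0 < k → k ≤ H → ∀ a : ℤ,
      ∑ r ∈ Finset.range R, f (a + (2 * k : ℕ) * r) ≤ (δ + ε) * R := by
    intro k hk hkH a
    obtain ⟨j, hj⟩ := Nat.dvd_factorial hk hkH
    have hjpos : 0 < j := by
      rcases Nat.eq_zero_or_pos j with h | h
      · rw [h, mul_zero] at hj; exact absurd hj (Nat.factorial_ne_zero _)
      · exact h
    have hRk : R = 2 * k * (j * L) := by rw [hR, hj]; ring
    have h1 := hA.card_step_le a (q := 2 * k) (by omega) (j * L)
    have h2 := hmax (j * L) (Nat.le_mul_of_pos_left _ hjpos)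
    have h3 : ∑ r ∈ Finset.range R, f (a + (2 * k : ℕ) * r)
        = ((Finset.range (2 * k * (j * L))).filter
          fun i : ℕ => a + (2 * k : ℕ) * i ∈ A).card := by
      simp only [hf]
      rw [Finset.sum_boole, hRk]
    rw [h3]
    calc _ ≤ ((2 * k * maxSquareDiffFree (j * L) : ℕ) : ℝ) := by exact_mod_cast h1
      _ = 2 * k * (maxSquareDiffFree (j * L) : ℝ) := by push_cast; ring
      _ ≤ 2 * k * ((δ + ε) * (j * L : ℕ)) := by gcongr
      _ = (δ + ε) * R := by rw [hRk]; push_cast; ring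
  set P : ℕ → ℕ → ℝ := fun h h' => ∑ r ∈ Finset.range R, ∑ n ∈ I,
    f (n + ((r + h + 1 : ℕ) : ℤ) ^ 2) * f (n + ((r + h' + 1 : ℕ) : ℤ) ^ 2) with hP
  have hPsymm : ∀ h h', P h h' = P h' h := by
    intro h h'
    exact Finset.sum_congr rfl fun r _ => Finset.sum_congr rfl fun n _ => mul_comm _ _
  have hPlt : ∀ h h', h < h' → h' < H → P h h' ≤ A.card * ((δ + ε) * R) := by
    intro h h' hlt hh'
    set k := h' - h with hk
    have hk' : h' = h + k := by omega
    have h1 : P h h' = ∑ r ∈ Finset.range R, ∑ x ∈ A,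
        f ((x + (2 * k * (h + 1) + k ^ 2 : ℕ)) + (2 * k : ℕ) * r) := by
      simp only [hP]
      refine Finset.sum_congr rfl fun r hr => ?_
      have h2 := hshift (fun x => f x * f ((x + (2 * k * (h + 1) + k ^ 2 : ℕ)) + (2 * k : ℕ) * r))
        (fun x hx => by simp [hfA x hx]) _ (by positivity)
        (hsq r (Finset.mem_range.1 hr) h (hlt.trans hh'))
      calc _ = _ := Finset.sum_congr rfl fun n _ => by
            congr 2
            rw [hk']; push_cast; ring
        _ = _ := h2
        _ = _ := Finset.sum_congr rfl fun x hx => by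
            have : f x = 1 := by simp [hf, hx]
            simp only [this, one_mul]
    rw [h1, Finset.sum_comm]
    calc _ ≤ ∑ x ∈ A, (δ + ε) * R :=
          Finset.sum_le_sum fun x _ => hstep k (by omega) (by omega) _
      _ = _ := by simp
  have hPdiag : ∀ h < H, P h h ≤ R * A.card := by
    intro h hh
    have h1 : P h h = ∑ r ∈ Finset.range R, (A.card : ℝ) := by
      simp only [hP]
      refine Finset.sum_congr rfl fun r hr => ?_
      have h2 := hshift (fun x => f x * f x) (fun x hx => by simp [hfA x hx]) _ (by positivity)
        (hsq r (Finset.mem_range.1 hr) h hh)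
      rw [h2, ← hsumf]
      exact Finset.sum_congr rfl fun x _ => by simp [hf]
    rw [h1]; simp
  have hε : 0 ≤ δ + ε := by
    have h1 : (0 : ℝ) ≤ maxSquareDiffFree L := by positivity
    have h2 : (0 : ℝ) < L := by exact_mod_cast hL
    exact nonneg_of_mul_nonneg_left (h1.trans (hmax L le_rfl)) h2
  have hPall : ∀ h ∈ Finset.range H, ∀ h' ∈ Finset.range H,
      P h h' ≤ A.card * ((δ + ε) * R) + if h = h' then (R * A.card : ℝ) else 0 := by
    intro h hh h' hh'
    rw [Finset.mem_range] at hh hh'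
    have h0 : (0 : ℝ) ≤ A.card * ((δ + ε) * R) :=
      mul_nonneg (Nat.cast_nonneg _) (mul_nonneg hε (Nat.cast_nonneg _))
    rcases lt_trichotomy h h' with hlt | rfl | hlt
    · rw [if_neg hlt.ne, add_zero]; exact hPlt _ _ hlt hh'
    · rw [if_pos rfl]; linarith [hPdiag h hh]
    · rw [if_neg hlt.ne', add_zero, hPsymm]; exact hPlt _ _ hlt hh
  have hsecond : ∑ r ∈ Finset.range R, ∑ n ∈ I, g r n ^ 2
      ≤ H ^ 2 * (A.card * ((δ + ε) * R)) + H * (R * A.card) := by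
    have h1 : ∑ r ∈ Finset.range R, ∑ n ∈ I, g r n ^ 2
        = ∑ h ∈ Finset.range H, ∑ h' ∈ Finset.range H, P h h' := by
      simp only [hg, hP, sq (Finset.sum _ _), Finset.sum_mul_sum]
      calc _ = ∑ r ∈ Finset.range R, ∑ h ∈ Finset.range H, ∑ n ∈ I, ∑ h' ∈ Finset.range H, _ :=
            Finset.sum_congr rfl fun r _ => Finset.sum_comm
        _ = ∑ r ∈ Finset.range R, ∑ h ∈ Finset.range H, ∑ h' ∈ Finset.range H, ∑ n ∈ I, _ :=
            Finset.sum_congr rfl fun r _ => Finset.sum_congr rfl fun h _ => Finset.sum_comm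
        _ = ∑ h ∈ Finset.range H, ∑ r ∈ Finset.range R, ∑ h' ∈ Finset.range H, ∑ n ∈ I, _ :=
            Finset.sum_comm
        _ = _ := Finset.sum_congr rfl fun h _ => Finset.sum_comm
    rw [h1]
    calc _ ≤ ∑ h ∈ Finset.range H, ∑ h' ∈ Finset.range H,
          (A.card * ((δ + ε) * R) + if h = h' then (R * A.card : ℝ) else 0) :=
          Finset.sum_le_sum fun h hh => Finset.sum_le_sum fun h' hh' => hPall h hh h' hh'
      _ = _ := by
          simp only [Finset.sum_add_distrib, Finset.sum_const, Finset.card_range, nsmul_eq_mul,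
            Finset.sum_ite_eq]
          rw [Finset.sum_ite_mem, Finset.inter_self]
          simp only [Finset.sum_const, Finset.card_range, nsmul_eq_mul]
          ring
  have hexpand : ∑ r ∈ Finset.range R, ∑ n ∈ I, (g r n - δ * H) ^ 2
      = ∑ r ∈ Finset.range R, ∑ n ∈ I, g r n ^ 2 - 2 * (δ * H) * (R * (H * A.card))
        + R * ((N + T) * (δ * H) ^ 2) := by
    have h1 : ∀ r ∈ Finset.range R, ∑ n ∈ I, (g r n - δ * H) ^ 2
        = ∑ n ∈ I, g r n ^ 2 - 2 * (δ * H) * (H * A.card) + (N + T) * (δ * H) ^ 2 := by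
      intro r hr
      rw [← hfirst r (Finset.mem_range.1 hr), ← hIcard, Finset.mul_sum, ← Finset.sum_sub_distrib,
        ← nsmul_eq_mul, ← Finset.sum_const, ← Finset.sum_add_distrib]
      exact Finset.sum_congr rfl fun n _ => by ring
    rw [Finset.sum_congr rfl h1]
    simp only [Finset.sum_add_distrib, Finset.sum_sub_distrib, Finset.sum_const,
      Finset.card_range, nsmul_eq_mul]
    ring
  have hlow : (R : ℝ) * (A.card * (δ * H) ^ 2)
      ≤ ∑ r ∈ Finset.range R, ∑ n ∈ I, (g r n - δ * H) ^ 2 := by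
    calc _ = ∑ r ∈ Finset.range R, (A.card : ℝ) * (δ * H) ^ 2 := by simp
      _ ≤ _ := Finset.sum_le_sum fun r hr => hlower r (Finset.mem_range.1 hr)
  have hTcast : (T : ℝ) = ((R + H : ℕ) : ℝ) ^ 2 := by rw [hT]; push_cast; ring
  rw [← hTcast]
  have hR' : (0 : ℝ) < R := by exact_mod_cast hRpos
  have hH' : (0 : ℝ) < H := by exact_mod_cast hH
  have hfin : (R * H ^ 2 : ℝ) * (A.card * δ ^ 2)
      ≤ (R * H ^ 2 : ℝ) * (A.card * (1 / H + ε) + T * δ ^ 2) := by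
    have h1 : (R * H ^ 2 : ℝ) * (A.card * (1 / H + ε) + T * δ ^ 2)
        = H * (R * A.card) + R * H ^ 2 * (A.card * ε + T * δ ^ 2) := by
      field_simp
      ring
    have h2 : (R * H ^ 2 * δ : ℝ) * (δ * N) ≤ (R * H ^ 2 * δ : ℝ) * A.card := by gcongr
    rw [h1]
    linarith [hlow, hexpand, hsecond]
  exact le_of_mul_le_mul_left hfin (by positivity)

/-- Sárközy's theorem: sets without nonzero square differences have density tending to zero. -/
theorem exists_maxSquareDiffFree_lt {η : ℝ} (hη : 0 < η) :
    ∃ M : ℕ, 0 < M ∧ (maxSquareDiffFree M : ℝ) < η * M := by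
  have hsub := subadditive_maxSquareDiffFree
  have hbdd : BddBelow (Set.range fun n => (maxSquareDiffFree n : ℝ) / n) :=
    ⟨0, by rintro _ ⟨n, rfl⟩; positivity⟩
  have hlim := hsub.tendsto_lim hbdd
  set δ := hsub.lim with hδ
  rcases le_or_gt δ 0 with h0 | hpos
  · obtain ⟨M, hM, hM0⟩ :=
      ((hlim.eventually (gt_mem_nhds (h0.trans_lt hη))).and (Filter.eventually_gt_atTop 0)).exists
    exact ⟨M, hM0, by rwa [div_lt_iff₀ (by exact_mod_cast hM0)] at hM⟩
  exfalso
  have hε : (0 : ℝ) < δ ^ 2 / 4 := by positivity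
  obtain ⟨L₀, hL₀⟩ := Filter.eventually_atTop.1
    (hlim.eventually (gt_mem_nhds (lt_add_of_pos_right δ hε)))
  obtain ⟨H, hH⟩ := exists_nat_one_div_lt hε
  have hmax : ∀ k, L₀ + 1 ≤ k → (maxSquareDiffFree k : ℝ) ≤ (δ + δ ^ 2 / 4) * k := by
    intro k hk
    have hk0 : (0 : ℝ) < k := by exact_mod_cast (show 0 < k by omega)
    exact ((div_lt_iff₀ hk0).1 (hL₀ k (by omega))).le
  set T : ℝ := ((2 * (H + 1).factorial * (L₀ + 1) + (H + 1) : ℕ) : ℝ) ^ 2 with hT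
  obtain ⟨N, hN⟩ := exists_nat_gt (2 * T / δ)
  have hN0 : 0 < N := by
    have : (0 : ℝ) ≤ 2 * T / δ := by positivity
    exact_mod_cast this.trans_lt hN
  obtain ⟨A, hAN, hfree, hcard⟩ := exists_card_eq_maxSquareDiffFree N
  have hA : δ * N ≤ A.card := by
    have := hsub.lim_le_div hbdd hN0.ne'
    rw [le_div_iff₀ (by exact_mod_cast hN0)] at this
    rw [hcard]; exact this
  have key := hfree.second_moment_le hpos hAN hA H.succ_pos L₀.succ_pos hmax
  rw [← hT] at key
  rw [div_lt_iff₀ hpos] at hN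
  have h1 : (A.card : ℝ) * (1 / ((H + 1 : ℕ) : ℝ)) ≤ A.card * (δ ^ 2 / 4) := by
    push_cast; gcongr
  have h2 : (A.card : ℝ) ≤ 2 * T := by
    have : δ ^ 2 * (A.card : ℝ) ≤ δ ^ 2 * (2 * T) := by linarith
    exact le_of_mul_le_mul_left this (by positivity)
  linarith

/-- Averaging over progressions with step `d ^ 2`: a dense subset of `{0, …, N - 1}` has many pairs
of elements with difference `(d * n) ^ 2`, `1 ≤ n < M`. -/
theorem card_le_sum_card_sq_sub {A : Finset ℤ} {N M d : ℕ} {δ : ℝ}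
    (hM0 : 0 < M) (hM : (maxSquareDiffFree M : ℝ) < δ / 4 * M) (hd : 0 < d)
    (hdN : d ^ 2 * M ≤ N) (hA : A ⊆ Finset.Ico (0 : ℤ) N) (hcard : δ * N ≤ A.card) :
    δ * N ≤ 2 * M * ∑ n ∈ Finset.Ico 1 M,
      (((A ×ˢ A).filter fun z => z.1 - z.2 = ((d * n : ℕ) : ℤ) ^ 2).card : ℝ) := by
  set J := Finset.Ico (-(N : ℤ)) N with hJ
  set cnt : ℤ → ℕ := fun a => ((Finset.range M).filter fun i : ℕ => a + d ^ 2 * i ∈ A).card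
    with hcnt
  set good := J.filter fun a => maxSquareDiffFree M < cnt a with hgood
  set E : ℕ → Finset (ℤ × ℤ) := fun n =>
    (A ×ˢ A).filter fun z => z.1 - z.2 = ((d * n : ℕ) : ℤ) ^ 2 with hE
  have hupper : good.card ≤ ∑ n ∈ Finset.Ico 1 M, (E n).card * M := by
    have hsub : good ⊆ (Finset.Ico 1 M).biUnion fun n =>
        (E n ×ˢ Finset.range M).image fun z => z.1.1 - d ^ 2 * (z.2 : ℤ) := by
      intro a ha
      obtain ⟨i, hi, j, -, n, hn, hij, hiA, hjA⟩ :=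
        exists_sq_of_maxSquareDiffFree_lt (Finset.mem_filter.1 ha).2
      have hnM : n < M := by
        have h1 : (n : ℤ) ≤ (n : ℤ) ^ 2 := by exact_mod_cast Nat.le_self_pow two_ne_zero n
        omega
      simp only [Finset.mem_biUnion, Finset.mem_image, Finset.mem_product, Finset.mem_Ico,
        Finset.mem_range, hE, Finset.mem_filter]
      refine ⟨n, ⟨hn, hnM⟩, ((a + d ^ 2 * i, a + d ^ 2 * j), i), ⟨⟨⟨hiA, hjA⟩, ?_⟩, hi⟩, ?_⟩
      · push_cast
        linear_combination (d : ℤ) ^ 2 * hij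
      · ring
    refine (Finset.card_le_card hsub).trans (Finset.card_biUnion_le.trans ?_)
    refine Finset.sum_le_sum fun n _ => Finset.card_image_le.trans ?_
    rw [Finset.card_product, Finset.card_range]
  have htotal : ∑ a ∈ J, cnt a = M * A.card := by
    simp only [hcnt, Finset.card_filter]
    rw [Finset.sum_comm]
    have h1 : ∀ i ∈ Finset.range M,
        ∑ a ∈ J, (if a + (d : ℤ) ^ 2 * i ∈ A then 1 else 0) = A.card := by
      intro i hi
      rw [← Finset.card_filter]
      refine Finset.card_nbij' (fun a => a + (d : ℤ) ^ 2 * i) (fun x => x - (d : ℤ) ^ 2 * i)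
        ?_ ?_ ?_ ?_
      · intro a ha; exact (Finset.mem_filter.1 ha).2
      · intro x hx
        have h2 := Finset.mem_Ico.1 (hA hx)
        have h3 : d ^ 2 * i ≤ N :=
          (Nat.mul_le_mul_left _ (Finset.mem_range.1 hi).le).trans hdN
        have h4 : (d : ℤ) ^ 2 * i ≤ N := by exact_mod_cast h3
        have h5 : (0 : ℤ) ≤ (d : ℤ) ^ 2 * i := by positivity
        simp only [Finset.coe_filter, Set.mem_ofPred_eq, hJ, Finset.mem_Ico, sub_add_cancel]
        exact ⟨⟨by omega, by omega⟩, hx⟩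
      · intro a _; simp
      · intro a _; simp
    rw [Finset.sum_congr rfl h1]; simp
  have hbound : ∑ a ∈ J, cnt a ≤ good.card * M + 2 * N * maxSquareDiffFree M := by
    have h1 : ∀ a ∈ J, cnt a ≤ (if maxSquareDiffFree M < cnt a then M else 0)
        + maxSquareDiffFree M := by
      intro a _
      split_ifs with h
      · exact ((Finset.card_filter_le _ _).trans_eq (Finset.card_range M)).trans
          (Nat.le_add_right _ _)
      · omega
    refine (Finset.sum_le_sum h1).trans_eq ?_
    rw [Finset.sum_add_distrib, ← Finset.sum_filter, Finset.sum_const, Finset.sum_const,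
      smul_eq_mul, smul_eq_mul]
    congr 2
    rw [hJ, Int.card_Ico]; omega
  have h1 : (M : ℝ) * A.card ≤ good.card * M + 2 * N * maxSquareDiffFree M := by
    exact_mod_cast htotal ▸ hbound
  have h2 : (good.card : ℝ) ≤ (∑ n ∈ Finset.Ico 1 M, ((E n).card : ℝ)) * M := by
    rw [Finset.sum_mul]; exact_mod_cast hupper
  have hM' : (0 : ℝ) < M := by exact_mod_cast hM0
  have h3 : (2 * N : ℝ) * maxSquareDiffFree M ≤ 2 * N * (δ / 4 * M) := by gcongr
  have h4 : (M : ℝ) * A.card ≤ M * (good.card + δ * N / 2) := by linarith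
  have h5 := le_of_mul_le_mul_left h4 hM'
  linarith

/-- In a dense subset of `{0, …, N - 1}`, some element has many square differences. -/
theorem exists_mem_le_card_sq_sub {δ : ℝ} (hδ : 0 < δ) :
    ∃ M : ℕ, 0 < M ∧ ∀ N K D : ℕ, K ^ 2 * M ≤ N → 2 * M ^ 2 * D < K * δ →
      ∀ A ⊆ Finset.Ico (0 : ℤ) N, δ * N ≤ A.card →
        ∃ x ∈ A, D ≤ (A.filter fun y => ∃ n : ℕ, 0 < n ∧ x - y = (n : ℤ) ^ 2).card := by
  obtain ⟨M, hM0, hM⟩ := exists_maxSquareDiffFree_lt (show 0 < δ / 4 by positivity)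
  refine ⟨M, hM0, fun N K D hKN hD A hA hcard => ?_⟩
  by_contra! hlt
  set S := (A ×ˢ A).filter fun z => ∃ n : ℕ, 0 < n ∧ z.1 - z.2 = (n : ℤ) ^ 2 with hS
  set E : ℕ → Finset (ℤ × ℤ) := fun m =>
    (A ×ˢ A).filter fun z => z.1 - z.2 = (m : ℤ) ^ 2 with hE
  have hScard : S.card ≤ N * D := by
    have h1 : S.card = ∑ x ∈ A,
        (A.filter fun y => ∃ n : ℕ, 0 < n ∧ x - y = (n : ℤ) ^ 2).card := by
      simp only [hS, Finset.card_filter, Finset.sum_product]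
    rw [h1]
    calc _ ≤ ∑ x ∈ A, D := Finset.sum_le_sum fun x hx => (hlt x hx).le
      _ = A.card * D := by simp
      _ ≤ N * D := by
        gcongr
        simpa using Finset.card_le_card hA
  have hdisj : ∀ n ∈ Finset.Ico 1 M, ∑ d ∈ Finset.Icc 1 K, (E (d * n)).card ≤ S.card := by
    intro n hn
    rw [Finset.mem_Ico] at hn
    rw [← Finset.card_biUnion]
    · refine Finset.card_le_card fun z hz => ?_
      simp only [Finset.mem_biUnion, hE, Finset.mem_filter, Finset.mem_Icc] at hz
      obtain ⟨d, hd, hz, hzd⟩ := hz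
      exact Finset.mem_filter.2 ⟨hz, d * n, Nat.mul_pos hd.1 hn.1, hzd⟩
    · intro d _ d' _ hne
      refine Finset.disjoint_left.2 fun z hz hz' => hne ?_
      have h1 := (Finset.mem_filter.1 hz).2.symm.trans (Finset.mem_filter.1 hz').2
      have h2 : (d * n) ^ 2 = (d' * n) ^ 2 := by exact_mod_cast h1
      exact Nat.eq_of_mul_eq_mul_right hn.1 (Nat.pow_left_injective two_ne_zero h2)
  have hsum : ∑ d ∈ Finset.Icc 1 K, ∑ n ∈ Finset.Ico 1 M, ((E (d * n)).card : ℝ)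
      ≤ M * (N * D) := by
    rw [Finset.sum_comm]
    calc _ ≤ ∑ n ∈ Finset.Ico 1 M, ((N : ℝ) * D) :=
          Finset.sum_le_sum fun n hn => by exact_mod_cast (hdisj n hn).trans hScard
      _ = (M - 1 : ℕ) * ((N : ℝ) * D) := by simp
      _ ≤ M * (N * D) := by
        gcongr
        omega
  have hlower : (K : ℝ) * (δ * N) ≤ 2 * M * (M * (N * D)) := by
    calc (K : ℝ) * (δ * N) = ∑ d ∈ Finset.Icc 1 K, δ * N := by simp
      _ ≤ ∑ d ∈ Finset.Icc 1 K, 2 * M * ∑ n ∈ Finset.Ico 1 M, ((E (d * n)).card : ℝ) := by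
        refine Finset.sum_le_sum fun d hd => ?_
        rw [Finset.mem_Icc] at hd
        exact card_le_sum_card_sq_sub hM0 hM hd.1
          ((Nat.mul_le_mul_right _ (Nat.pow_le_pow_left hd.2 2)).trans hKN) hA hcard
      _ ≤ _ := by rw [← Finset.mul_sum]; gcongr
  have hN : (0 : ℝ) < N := by
    have hK : 0 < K := by
      rcases Nat.eq_zero_or_pos K with rfl | h
      · have : (0 : ℝ) ≤ 2 * M ^ 2 * D := by positivity
        simp at hD; linarith
      · exact h
    have : 0 < K ^ 2 * M := by positivity
    exact_mod_cast this.trans_le hKN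
  have := mul_lt_mul_of_pos_right hD hN
  nlinarith

/-- Containers: if every set of at least `m` vertices has a vertex of degree at least `D`, then the
independent sets are covered by few sets of fewer than `m` vertices, up to few elements each. -/
theorem exists_containers {V : Type*} [DecidableEq V] (r : V → V → Prop) {D m : ℕ} {t : ℝ} (ht : 0 ≤ t)
    (hD : 0 < D) (hexp : Real.exp (-t) + Real.exp (-(t * D)) ≤ 1)
    (hdeg : ∀ X : Finset V, m ≤ X.card → ∃ v ∈ X, D ≤ (X.filter (r v)).card) (X : Finset V) :
    ∃ 𝒞 : Finset (Finset V), (𝒞.card : ℝ) ≤ Real.exp (t * X.card) ∧ (∀ C ∈ 𝒞, C.card < m) ∧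
      ∀ I ⊆ X, (∀ u ∈ I, ∀ v ∈ I, ¬ r u v) → ∃ C ∈ 𝒞, (I \ C).card * D ≤ X.card := by
  induction h : X.card using Nat.strong_induction_on generalizing X with
  | _ k ih =>
  rcases lt_or_ge X.card m with hlt | hge
  · refine ⟨{X}, ?_, by simpa using hlt, fun I hI _ => ⟨X, by simp, ?_⟩⟩
    · simp only [Finset.card_singleton, Nat.cast_one]
      exact Real.one_le_exp (by positivity)
    · simp [Finset.sdiff_eq_empty_iff_subset.2 hI]
  obtain ⟨v, hv, hvD⟩ := hdeg X hge
  have hc₁ : (X.erase v).card = k - 1 := by rw [Finset.card_erase_of_mem hv, h]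
  have hk : 0 < k := h ▸ Finset.card_pos.2 ⟨v, hv⟩
  have hc₂ : (X.filter fun u => ¬ r v u).card + D ≤ k := by
    have := Finset.card_filter_add_card_filter_not (s := X) (r v)
    omega
  obtain ⟨𝒞₁, hcard₁, hsize₁, hcov₁⟩ := ih _ (by omega) (X.erase v) rfl
  obtain ⟨𝒞₂, hcard₂, hsize₂, hcov₂⟩ := ih _ (by omega) (X.filter fun u => ¬ r v u) rfl
  refine ⟨𝒞₁ ∪ 𝒞₂, ?_, ?_, ?_⟩
  · calc ((𝒞₁ ∪ 𝒞₂).card : ℝ) ≤ 𝒞₁.card + 𝒞₂.card := by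
          exact_mod_cast Finset.card_union_le _ _
      _ ≤ Real.exp (-t + t * k) + Real.exp (-(t * D) + t * k) := by
        refine add_le_add (hcard₁.trans ?_) (hcard₂.trans ?_) <;> rw [Real.exp_le_exp]
        · rw [hc₁, Nat.cast_sub hk]
          push_cast
          linarith
        · have : ((X.filter fun u => ¬ r v u).card : ℝ) + D ≤ k := by exact_mod_cast hc₂
          nlinarith
      _ = (Real.exp (-t) + Real.exp (-(t * D))) * Real.exp (t * k) := by
        rw [Real.exp_add, Real.exp_add]; ring
      _ ≤ Real.exp (t * k) := mul_le_of_le_one_left (Real.exp_pos _).le hexp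
  · intro C hC
    rcases Finset.mem_union.1 hC with hC | hC
    exacts [hsize₁ C hC, hsize₂ C hC]
  · intro I hI hind
    by_cases hvI : v ∈ I
    · obtain ⟨C, hC, hIC⟩ := hcov₂ (I.erase v) (fun u hu => by
          have hu' := Finset.mem_of_mem_erase hu
          exact Finset.mem_filter.2 ⟨hI hu', hind v hvI u hu'⟩)
        fun u hu w hw => hind u (Finset.mem_of_mem_erase hu) w (Finset.mem_of_mem_erase hw)
      refine ⟨C, Finset.mem_union_right _ hC, ?_⟩
      have h1 : (I \ C).card ≤ (I.erase v \ C).card + 1 := by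
        refine (Finset.card_le_card (t := insert v (I.erase v \ C)) fun u hu => ?_).trans
          (Finset.card_insert_le _ _)
        rw [Finset.mem_sdiff] at hu
        by_cases huv : u = v
        · simp [huv]
        · simp [huv, hu.1, hu.2]
      calc (I \ C).card * D ≤ ((I.erase v \ C).card + 1) * D := Nat.mul_le_mul_right _ h1
        _ = (I.erase v \ C).card * D + D := by ring
        _ ≤ k := by omega
    · obtain ⟨C, hC, hIC⟩ := hcov₁ I (Finset.subset_erase.2 ⟨hI, hvI⟩) hind
      exact ⟨C, Finset.mem_union_left _ hC, by omega⟩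

theorem sum_weight_mul_prod (N : ℕ) [NeZero N] (p : ℝ) (u : ZMod N → ℝ) :
    ∑ W ∈ (Finset.univ : Finset (ZMod N)).powerset,
        p ^ W.card * (1 - p) ^ (N - W.card) * ∏ x ∈ W, u x
      = ∏ x, (p * u x + (1 - p)) := by
  rw [Finset.prod_add]
  refine Finset.sum_congr rfl fun W _ => ?_
  rw [Finset.prod_mul_distrib, Finset.prod_const, Finset.prod_const,
    Finset.card_sdiff_of_subset (Finset.subset_univ W), Finset.card_univ, ZMod.card]
  ring

theorem sum_weight (N : ℕ) [NeZero N] (p : ℝ) :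
    ∑ W ∈ (Finset.univ : Finset (ZMod N)).powerset, p ^ W.card * (1 - p) ^ (N - W.card) = 1 := by
  simpa using sum_weight_mul_prod N p fun _ => 1

theorem sum_weight_mul_exp_le {N : ℕ} [NeZero N] {p α η : ℝ} (hp0 : 0 ≤ p)
    (hα : 0 < α) (hη : 2 * η = 1 - Real.exp (-α)) (C : Finset (ZMod N))
    (hC : 3 * (C.card : ℝ) ≤ η * N) (hp1 : p ≤ 1) :
    ∑ W ∈ (Finset.univ : Finset (ZMod N)).powerset,
        p ^ W.card * (1 - p) ^ (N - W.card) * Real.exp ((W ∩ C).card - α * W.card)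
      ≤ Real.exp (-(η * p * N)) := by
  set u : ZMod N → ℝ := fun x => Real.exp ((if x ∈ C then 1 else 0) - α) with hu
  have hprod : ∀ W : Finset (ZMod N),
      Real.exp ((W ∩ C).card - α * W.card) = ∏ x ∈ W, u x := by
    intro W
    rw [hu, ← Real.exp_sum, Finset.sum_sub_distrib, Finset.sum_const, Finset.sum_boole,
      Finset.filter_mem_eq_inter, nsmul_eq_mul, mul_comm α]
  simp only [hprod]
  rw [sum_weight_mul_prod]
  have hu1 : ∀ x, u x - 1 ≤ 3 * (if x ∈ C then 1 else 0) - 2 * η := by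
    intro x
    have hpos := Real.exp_pos (-α)
    simp only [hu]
    split_ifs
    · have h1 : Real.exp (1 - α) ≤ Real.exp 1 := Real.exp_le_exp.2 (by linarith)
      have h2 := Real.exp_one_lt_three
      linarith
    · rw [zero_sub]; linarith
  calc ∏ x, (p * u x + (1 - p)) ≤ ∏ x, Real.exp (p * (u x - 1)) := by
        refine Finset.prod_le_prod (fun x _ => ?_) fun x _ => ?_
        · have := (Real.exp_pos ((if x ∈ C then 1 else 0) - α)).le
          exact add_nonneg (mul_nonneg hp0 this) (by linarith)
        · linarith [Real.add_one_le_exp (p * (u x - 1))]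
    _ = Real.exp (p * ∑ x, (u x - 1)) := by rw [← Real.exp_sum, Finset.mul_sum]
    _ ≤ Real.exp (p * (3 * C.card - 2 * η * N)) := by
        rw [Real.exp_le_exp]
        refine mul_le_mul_of_nonneg_left ((Finset.sum_le_sum fun x _ => hu1 x).trans_eq ?_) hp0
        rw [Finset.sum_sub_distrib, ← Finset.mul_sum, Finset.sum_boole, Finset.sum_const,
          Finset.card_univ, ZMod.card, Finset.filter_mem_eq_inter, Finset.univ_inter]
        simp
        ring
    _ ≤ Real.exp (-(η * p * N)) := by
        rw [Real.exp_le_exp]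
        nlinarith

/-- Union bound over containers for the complement of an event. -/
theorem one_sub_le_randomSetProb {N : ℕ} [NeZero N] {p α η B : ℝ} (hp0 : 0 ≤ p) (hp1 : p ≤ 1)
    (hα : 0 < α) (hη : 2 * η = 1 - Real.exp (-α)) (𝒞 : Finset (Finset (ZMod N)))
    (h𝒞 : ∀ C ∈ 𝒞, 3 * (C.card : ℝ) ≤ η * N) {E : Finset (ZMod N) → Prop}
    (hE : ∀ W, ¬ E W → ∃ C ∈ 𝒞, α * W.card ≤ (W ∩ C).card + B) :
    1 - 𝒞.card * Real.exp (B - η * p * N) ≤ randomSetProb N p E := by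
  have hw : ∀ W : Finset (ZMod N), 0 ≤ p ^ W.card * (1 - p) ^ (N - W.card) := fun W =>
    mul_nonneg (pow_nonneg hp0 _) (pow_nonneg (by linarith) _)
  have hpoint : ∀ W : Finset (ZMod N), p ^ W.card * (1 - p) ^ (N - W.card)
      ≤ (if E W then p ^ W.card * (1 - p) ^ (N - W.card) else 0)
        + ∑ C ∈ 𝒞, Real.exp B * (p ^ W.card * (1 - p) ^ (N - W.card)
          * Real.exp ((W ∩ C).card - α * W.card)) := by
    intro W
    have hnonneg : ∀ C ∈ 𝒞, 0 ≤ Real.exp B * (p ^ W.card * (1 - p) ^ (N - W.card)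
        * Real.exp ((W ∩ C).card - α * W.card)) := fun C _ =>
      mul_nonneg (Real.exp_pos _).le (mul_nonneg (hw W) (Real.exp_pos _).le)
    by_cases hW : E W
    · rw [if_pos hW]
      exact le_add_of_nonneg_right (Finset.sum_nonneg hnonneg)
    · rw [if_neg hW, zero_add]
      obtain ⟨C, hC, hCW⟩ := hE W hW
      refine le_trans ?_ (Finset.single_le_sum hnonneg hC)
      rw [mul_left_comm, ← Real.exp_add]
      exact le_mul_of_one_le_right (hw W) (Real.one_le_exp (by linarith))
  have hsum := Finset.sum_le_sum fun W (_ : W ∈ (Finset.univ : Finset (ZMod N)).powerset) =>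
    hpoint W
  rw [sum_weight, Finset.sum_add_distrib, Finset.sum_comm] at hsum
  have hmgf : ∑ C ∈ 𝒞, ∑ W ∈ (Finset.univ : Finset (ZMod N)).powerset,
      Real.exp B * (p ^ W.card * (1 - p) ^ (N - W.card) * Real.exp ((W ∩ C).card - α * W.card))
      ≤ 𝒞.card * Real.exp (B - η * p * N) := by
    rw [← nsmul_eq_mul]
    refine Finset.sum_le_card_nsmul _ _ _ fun C hC => ?_
    rw [← Finset.mul_sum, sub_eq_add_neg B, Real.exp_add]
    exact mul_le_mul_of_nonneg_left (sum_weight_mul_exp_le hp0 hα hη C (h𝒞 C hC) hp1)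
      (Real.exp_pos _).le
  rw [randomSetProb]
  linarith

/-- The degree `D` and the rate `t` at which the container lemma is applied. -/
theorem exists_container_parameters {M : ℕ} {δ z : ℝ} (hδ : 0 < δ) (hz : 2 ≤ z)
    (hzM : M ≤ z) (hzδ : 2 * (M : ℝ) ^ 2 / δ + 2 ≤ z) :
    ∃ K D : ℕ, ((K ^ 2 * M : ℕ) : ℝ) ≤ z ^ 16 ∧ 2 * (M : ℝ) ^ 2 * D < K * δ ∧ 0 < D ∧
      z ^ 16 / D ≤ 2 * z ^ 12 ∧
      Real.exp (-(1 / z ^ 2)) + Real.exp (-(1 / z ^ 2 * D)) ≤ 1 := by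
  have hz0 : 0 < z := by linarith
  have hz4 : (16 : ℝ) ≤ z ^ 4 := by
    calc (16 : ℝ) = 2 ^ 4 := by norm_num
      _ ≤ z ^ 4 := by gcongr
  have hD1 := Nat.sub_one_lt_floor (z ^ 4)
  have hD2 := Nat.floor_le (show 0 ≤ z ^ 4 by positivity)
  have hK1 := Nat.sub_one_lt_floor (z ^ 6)
  have hK2 := Nat.floor_le (show 0 ≤ z ^ 6 by positivity)
  set D := ⌊z ^ 4⌋₊
  set K := ⌊z ^ 6⌋₊
  have hDpos : (0 : ℝ) < D := by linarith
  refine ⟨K, D, ?_, ?_, by exact_mod_cast hDpos, ?_, ?_⟩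
  · push_cast
    calc (K : ℝ) ^ 2 * M ≤ (z ^ 6) ^ 2 * z := by gcongr
      _ = z ^ 13 := by ring
      _ ≤ z ^ 16 := pow_le_pow_right₀ (by linarith) (by norm_num)
  · have h1 : 2 * (M : ℝ) ^ 2 ≤ (z - 2) * δ := by
      rw [← div_le_iff₀ hδ]; linarith
    have h2 : z ^ 5 ≤ z ^ 6 := pow_le_pow_right₀ (by linarith) (by norm_num)
    calc 2 * (M : ℝ) ^ 2 * D ≤ (z - 2) * δ * z ^ 4 := by gcongr
      _ = (z ^ 5 - 2 * z ^ 4) * δ := by ring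
      _ < K * δ := by
        gcongr
        linarith
  · rw [div_le_iff₀ hDpos]
    calc z ^ 16 = 2 * z ^ 12 * (z ^ 4 / 2) := by ring
      _ ≤ 2 * z ^ 12 * D := by
        gcongr
        linarith
  · have hy : 4 ≤ z ^ 2 := by nlinarith
    set y := z ^ 2
    have hy0 : 0 < y := by linarith
    have h1 : Real.exp (-(1 / y)) ≤ y / (y + 1) := by
      rw [Real.exp_neg, inv_le_comm₀ (Real.exp_pos _) (by positivity), inv_div]
      have : (y + 1) / y = 1 / y + 1 := by field_simp; ring
      rw [this]
      exact Real.add_one_le_exp _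
    have h2 : y - 1 ≤ 1 / y * D := by
      rw [div_mul_eq_mul_div, one_mul, le_div_iff₀ hy0]
      have : z ^ 4 = y ^ 2 := by ring
      nlinarith
    have h3 : Real.exp (-(1 / y * D)) ≤ 1 / (y + 1) := by
      rw [Real.exp_neg, inv_le_comm₀ (Real.exp_pos _) (by positivity), one_div, inv_inv]
      have h4 := Real.quadratic_le_exp_of_nonneg (show 0 ≤ 1 / y * D by positivity)
      nlinarith
    calc _ ≤ y / (y + 1) + 1 / (y + 1) := add_le_add h1 h3
      _ = 1 := by rw [← add_div, div_self (by linarith)]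

/-- S\'ark\"ozy's theorem in random sets: with probability `1 - o_α(1)`, every subset of
the random set `W` of relative density at least `α` contains two elements differing by a
nonzero perfect square. -/
theorem sarkozy_in_random_sets (θ c α : ℝ) (hθ : 0 < θ) (hθ' : θ < 1 / 110)
    (hc : 0 < c) (hα : 0 < α) :
    ∀ ε : ℝ, 0 < ε → ∃ N₀ : ℕ, ∀ N : ℕ, N₀ ≤ N → N.Prime → ∀ [NeZero N],
      ∀ p : ℝ, c * (N : ℝ) ^ (-θ) < p → p ≤ 1 →
        1 - ε ≤ randomSetProb N p (fun W =>
          ∀ A ⊆ W, α * (W.card : ℝ) ≤ (A.card : ℝ) →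
            ∃ x ∈ A, ∃ y ∈ A, ∃ n : ℕ, 0 < n ∧
              (x.val : ℤ) - (y.val : ℤ) = (n : ℤ) ^ 2) := by
  intro ε hε
  obtain ⟨η, hη⟩ : ∃ η : ℝ, 2 * η = 1 - Real.exp (-α) := ⟨_, mul_div_cancel₀ _ two_ne_zero⟩
  have hη0 : 0 < η := by
    have : Real.exp (-α) < 1 := Real.exp_lt_one_iff.2 (by linarith)
    linarith
  have hδ : 0 < η / 3 := by positivity
  obtain ⟨M, -, hM⟩ := exists_mem_le_card_sq_sub hδ
  have hz_tendsto : Filter.Tendsto (fun N : ℕ => (N : ℝ) ^ (1 / 16 : ℝ)) Filter.atTop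
      Filter.atTop :=
    (tendsto_rpow_atTop (by norm_num)).comp tendsto_natCast_atTop_atTop
  obtain ⟨N₀, hN₀⟩ := Filter.eventually_atTop.1 (hz_tendsto.eventually
    ((((Filter.eventually_ge_atTop (2 : ℝ)).and (Filter.eventually_ge_atTop (M : ℝ))).and
      (Filter.eventually_ge_atTop (2 * (M : ℝ) ^ 2 / (η / 3) + 2))).and
      ((Filter.eventually_ge_atTop (4 / (η * c))).and
      (Filter.eventually_ge_atTop (-Real.log ε)))))
  refine ⟨N₀, fun N hN _ _ p hp hp1 => ?_⟩
  obtain ⟨⟨⟨hz2, hzM⟩, hzδ⟩, hzc, hzε⟩ := hN₀ N hN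
  have hN1 : (1 : ℝ) ≤ N := by exact_mod_cast NeZero.one_le
  have hz16 : ((N : ℝ) ^ (1 / 16 : ℝ)) ^ 16 = N := by
    rw [← Real.rpow_natCast, ← Real.rpow_mul (by positivity)]
    norm_num
  have hzθ : ((N : ℝ) ^ (1 / 16 : ℝ))⁻¹ ≤ (N : ℝ) ^ (-θ) := by
    rw [← Real.rpow_neg (by positivity)]
    exact Real.rpow_le_rpow_of_exponent_le hN1 (by linarith)
  set z := (N : ℝ) ^ (1 / 16 : ℝ)
  have hz0 : 0 < z := by linarith
  have hp0 : 0 < p := lt_trans (by positivity) hp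
  obtain ⟨K, D, hKM, hKD, hD, hND, hexp⟩ := exists_container_parameters hδ hz2 hzM hzδ
  rw [hz16] at hKM hND
  have hdeg : ∀ X : Finset (ZMod N), ⌈η / 3 * N⌉₊ ≤ X.card → ∃ x ∈ X,
      D ≤ (X.filter fun y => ∃ n : ℕ, 0 < n ∧ (x.val : ℤ) - (y.val : ℤ) = (n : ℤ) ^ 2).card := by
    intro X hX
    have hinj : Function.Injective fun x : ZMod N => (x.val : ℤ) :=
      Nat.cast_injective.comp (ZMod.val_injective N)
    obtain ⟨x, hx, hxD⟩ := hM N K D (by exact_mod_cast hKM) hKD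
      (X.image fun x : ZMod N => (x.val : ℤ))
      (fun a ha => by
        obtain ⟨x, -, rfl⟩ := Finset.mem_image.1 ha
        exact Finset.mem_Ico.2 ⟨Int.natCast_nonneg _, by exact_mod_cast ZMod.val_lt x⟩)
      (by rw [Finset.card_image_of_injective _ hinj]; exact Nat.ceil_le.1 hX)
    obtain ⟨v, hv, rfl⟩ := Finset.mem_image.1 hx
    refine ⟨v, hv, hxD.trans ?_⟩
    rw [Finset.filter_image]
    exact Finset.card_image_le
  obtain ⟨𝒞, h𝒞card, h𝒞size, h𝒞⟩ := exists_containers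
    (fun x y : ZMod N => ∃ n : ℕ, 0 < n ∧ (x.val : ℤ) - (y.val : ℤ) = (n : ℤ) ^ 2) (by positivity)
    hD hexp hdeg Finset.univ
  have hbound := one_sub_le_randomSetProb (N := N) (B := 2 * z ^ 12) hp0.le hp1 hα hη 𝒞
    (fun C hC => by linarith [Nat.lt_ceil.1 (h𝒞size C hC)])
    (E := fun W => ∀ A ⊆ W, α * (W.card : ℝ) ≤ (A.card : ℝ) →
          ∃ x ∈ A, ∃ y ∈ A, ∃ n : ℕ, 0 < n ∧
            (x.val : ℤ) - (y.val : ℤ) = (n : ℤ) ^ 2) ?_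
  · refine le_trans (sub_le_sub_left ?_ 1) hbound
    rw [Finset.card_univ, ZMod.card] at h𝒞card
    calc (𝒞.card : ℝ) * Real.exp (2 * z ^ 12 - η * p * N)
        ≤ Real.exp (1 / z ^ 2 * N) * Real.exp (2 * z ^ 12 - η * p * N) := by gcongr
      _ = Real.exp (1 / z ^ 2 * N + (2 * z ^ 12 - η * p * N)) := (Real.exp_add _ _).symm
      _ ≤ Real.exp (Real.log ε) := by
        rw [Real.exp_le_exp]
        have h1 : 1 / z ^ 2 * N = z ^ 14 := by
          rw [← hz16]; field_simp
        have h2 : 4 * z ^ 14 ≤ η * p * N := by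
          calc 4 * z ^ 14 ≤ z * (η * c) * z ^ 14 := by
                gcongr
                rwa [div_le_iff₀ (by positivity)] at hzc
            _ = η * (c * z⁻¹) * z ^ 16 := by field_simp
            _ ≤ η * p * N := by
              rw [hz16]
              gcongr
              exact (mul_le_mul_of_nonneg_left hzθ hc.le).trans hp.le
        have h3 : z ^ 12 ≤ z ^ 14 := pow_le_pow_right₀ (by linarith) (by norm_num)
        have h4 : z ≤ z ^ 14 := le_self_pow₀ (by linarith) (by norm_num)
        linarith
      _ = ε := Real.exp_log hε
  · intro W hW
    push Not at hW
    obtain ⟨A, hAW, hA, hfree⟩ := hW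
    obtain ⟨C, hC, hAC⟩ := h𝒞 A (Finset.subset_univ A) fun x hx y hy ⟨n, hn, h⟩ =>
      hfree x hx y hy n hn h
    refine ⟨C, hC, ?_⟩
    rw [Finset.card_univ, ZMod.card] at hAC
    have h1 : ((A \ C).card : ℝ) ≤ N / D := by
      rw [le_div_iff₀ (by exact_mod_cast hD)]
      exact_mod_cast hAC
    have h2 : (A.card : ℝ) ≤ (W ∩ C).card + (A \ C).card := by
      rw [← Finset.card_inter_add_card_sdiff A C]
      push_cast
      gcongr
    linarith
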